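/- Let b ∈ ℝ, let n ≥ 2 be an integer and let a < −n. Define B_n(0) = −ab/((a+n)(a+n−1)), B_n(1) = −b/(a+n) and B_n(2) = −b/(a+1). Then for each i ∈ {0,1,2} there exist real numbers u and v with P_n(u;a,b) = 0, P_n(v;a,b) = 0 and u < B_n(i) < v; that is, each B_n(i) is a strict upper bound for the smallest real zero and a strict lower bound for the largest real zero of the Pseudo-Jacobi polynomial P_n(x;a,b). -/

import Mathlib

open scoped BigOperators

/-- Pochhammer symbol `(α)_j = α(α+1)⋯(α+j−1)` in a commutative semiring. -/
noncomputable def poch {R : Type*} [CommSemiring R] (α : R) (j : ℕ) : R :=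
  ∏ i ∈ Finset.range j, (α + i)

/-- The monic Pseudo-Jacobi polynomial
`P_n(x;a,b) = [2ⁿ (a+ib+1)_n / (iⁿ (2a+n+1)_n)] ·
  Σ_{j=0}^{n} [(−n)_j (2a+n+1)_j / ((a+ib+1)_j · j!)] ((1−ix)/2)^j`. -/
noncomputable def pseudoJacobi (a b : ℝ) (n : ℕ) (x : ℂ) : ℂ :=
  2 ^ n * poch ((a : ℂ) + Complex.I * (b : ℂ) + 1) n /
      (Complex.I ^ n * poch (2 * (a : ℂ) + (n : ℂ) + 1) n) *
    ∑ j ∈ Finset.range (n + 1),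
      poch (-(n : ℂ)) j * poch (2 * (a : ℂ) + (n : ℂ) + 1) j /
          (poch ((a : ℂ) + Complex.I * (b : ℂ) + 1) j * (j.factorial : ℂ)) *
        ((1 - Complex.I * x) / 2) ^ j

/-- The inner bounds `B_n(0) = −ab/((a+n)(a+n−1))`, `B_n(1) = −b/(a+n)`,
`B_n(2) = −b/(a+1)` for the extreme zeros of the Pseudo-Jacobi polynomial. -/
noncomputable def pjBound (a b : ℝ) (n : ℕ) : Fin 3 → ℝ :=
  ![-(a * b) / ((a + n) * (a + n - 1)), -b / (a + n), -b / (a + 1)]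

theorem poch_zero {R : Type*} [CommSemiring R] (α : R) : poch α 0 = 1 := by simp [poch]

theorem poch_succ {R : Type*} [CommSemiring R] (α : R) (j : ℕ) :
    poch α (j + 1) = poch α j * (α + j) := by simp [poch, Finset.prod_range_succ]

theorem poch_succ' {R : Type*} [CommSemiring R] (α : R) (j : ℕ) :
    poch α (j + 1) = α * poch (α + 1) j := by
  simp only [poch, Finset.prod_range_succ']
  rw [mul_comm]
  simp [add_comm, add_left_comm]

/-- The factor in front of the hypergeometric sum, for the variable `t = (1 - i x) / 2` and with
`β = i b`. -/
noncomputable def pjLead (a β : ℂ) (k : ℕ) : ℂ :=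
  (-1) ^ k * poch (a + β + 1) k / poch (2 * a + k + 1) k

/-- The coefficient of `t ^ j` in the Pseudo-Jacobi polynomial of degree `k`, made monic in
`t = (1 - i x) / 2`, where `β = i b`. -/
noncomputable def pjCoeff (a β : ℂ) (k j : ℕ) : ℂ :=
  pjLead a β k *
    (poch (-(k : ℂ)) j * poch (2 * a + k + 1) j / (poch (a + β + 1) j * (j.factorial : ℂ)))

theorem poch_two_mul_add {A : ℂ} {k : ℕ} (h : A * 2 - k ≠ 0) (i : ℕ) :
    poch (A * 2 - k + 1) i = poch (A * 2 - k) i * (A * 2 - k + i) / (A * 2 - k) := by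
  rw [← poch_succ, poch_succ', mul_div_cancel_left₀ _ h]

theorem exists_pjLead_eq {A β : ℂ} {k : ℕ}
    (h : ∀ m : ℕ, m ≤ k + 2 → A * 2 - k - 1 + m ≠ 0) :
    ∃ Z : ℂ, pjLead (A - k - 1) β k = Z * (A * 2 - 1) / (A * 2 - k - 1) ∧
      pjLead (A - k - 1) β (k + 1) = -Z * (A + β) / (A * 2) ∧
      pjLead (A - k - 1) β (k + 2) =
        Z * (A + β) * (A + β + 1) * (A * 2 - k) / (A * 2 * (A * 2 + 1) * (A * 2 + 2)) := by
  have n0 : A * 2 - k - 1 ≠ 0 := by simpa using h 0 (by omega)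
  have n1 : A * 2 - k ≠ 0 := by simpa using h 1 (by omega)
  have f0 : poch (A * 2 - k) k ≠ 0 := by
    rw [poch, Finset.prod_ne_zero_iff]
    intro i hi
    have := h (i + 1) (by have := Finset.mem_range.1 hi; omega)
    rwa [show A * 2 - k - 1 + (i + 1 : ℕ) = A * 2 - k + i by push_cast; ring] at this
  have n2 : A * 2 - 1 ≠ 0 := by
    have := h k (by omega)
    rwa [show A * 2 - k - 1 + k = A * 2 - 1 by ring] at this
  have n3 : A * 2 ≠ 0 := by
    have := h (k + 1) (by omega)
    rwa [show A * 2 - k - 1 + (k + 1 : ℕ) = A * 2 by push_cast; ring] at this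
  refine ⟨(-1) ^ k * poch (A - k - 1 + β + 1) k / poch (A * 2 - k) k, ?_, ?_, ?_⟩
  · have e : poch (A * 2 - k - 1) k =
        (A * 2 - k - 1) * poch (A * 2 - k) k / (A * 2 - 1) := by
      have := poch_succ' (A * 2 - k - 1) k
      rw [poch_succ, sub_add_cancel] at this
      rw [eq_div_iff n2, ← this]
      ring
    rw [pjLead, show 2 * (A - k - 1) + k + 1 = A * 2 - k - 1 by ring, e]
    field_simp
  · rw [pjLead, show 2 * (A - k - 1) + (k + 1 : ℕ) + 1 = A * 2 - k by push_cast; ring,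
      poch_succ, poch_succ, show A - k - 1 + β + 1 + k = A + β by ring,
      show A * 2 - k + k = A * 2 by ring]
    field_simp
    ring
  · rw [pjLead, show 2 * (A - k - 1) + (k + 2 : ℕ) + 1 = A * 2 - k + 1 by push_cast; ring,
      poch_two_mul_add n1]
    simp only [poch_succ]
    push_cast
    rw [show A - k - 1 + β + 1 + k = A + β by ring,
      show A - k - 1 + β + 1 + (k + 1) = A + β + 1 by ring,
      show A * 2 - k + k = A * 2 by ring, show A * 2 - k + (k + 1) = A * 2 + 1 by ring,
      show A * 2 - k + (k + 2) = A * 2 + 2 by ring]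
    field_simp
    ring

theorem pjCoeff_zero_rec {A β : ℂ} {k : ℕ} (hA : A ≠ 0) (hA1 : A + 1 ≠ 0)
    (h3 : A * 2 + 1 ≠ 0) (h1 : A * 2 - 1 ≠ 0)
    (h : ∀ m : ℕ, m ≤ k + 2 → A * 2 - k - 1 + m ≠ 0) :
    pjCoeff (A - k - 1) β (k + 2) 0 =
      (-1 / 2 - (A - k - 1) * β / (A * (A + 1)) / 2) * pjCoeff (A - k - 1) β (k + 1) 0 -
      ((k + 1) * (A * 2 - k - 1) * (A ^ 2 - β ^ 2) /
        (A ^ 2 * (A * 2 - 1) * (A * 2 + 1))) / 4 * pjCoeff (A - k - 1) β k 0 := by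
  obtain ⟨Z, z0, z1, z2⟩ := exists_pjLead_eq (β := β) h
  have n0 : A * 2 - k - 1 ≠ 0 := by simpa using h 0 (by omega)
  simp only [pjCoeff, z0, z1, z2, poch_zero]
  generalize (k : ℂ) = k at *
  rw [show A * 2 + 2 = 2 * (A + 1) by ring]
  field_simp
  ring

theorem pjCoeff_succ_rec {A β : ℂ} {k j : ℕ} (hA : A ≠ 0) (hA1 : A + 1 ≠ 0)
    (h3 : A * 2 + 1 ≠ 0) (h1 : A * 2 - 1 ≠ 0)
    (h : ∀ m : ℕ, m ≤ k + 2 → A * 2 - k - 1 + m ≠ 0)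
    (hp : poch (A - k - 1 + β + 1) (j + 1) ≠ 0) :
    pjCoeff (A - k - 1) β (k + 2) (j + 1) = pjCoeff (A - k - 1) β (k + 1) j +
      (-1 / 2 - (A - k - 1) * β / (A * (A + 1)) / 2) * pjCoeff (A - k - 1) β (k + 1) (j + 1) -
      ((k + 1) * (A * 2 - k - 1) * (A ^ 2 - β ^ 2) /
        (A ^ 2 * (A * 2 - 1) * (A * 2 + 1))) / 4 * pjCoeff (A - k - 1) β k (j + 1) := by
  obtain ⟨Z, z0, z1, z2⟩ := exists_pjLead_eq (β := β) h
  have n0 : A * 2 - k - 1 ≠ 0 := by simpa using h 0 (by omega)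
  have n1 : A * 2 - k ≠ 0 := by simpa using h 1 (by omega)
  have hk : (k : ℂ) + 1 ≠ 0 := by exact_mod_cast k.succ_ne_zero
  have e1 : poch (-((k + 2 : ℕ) : ℂ)) (j + 1) = -(k + 2) * poch (-(k + 1 : ℂ)) j := by
    rw [poch_succ']
    push_cast
    congr 2
    ring
  have e2 (i : ℕ) : poch (-((k + 1 : ℕ) : ℂ)) i = poch (-(k + 1 : ℂ)) i := by push_cast; rfl
  have e3 : poch (-(k : ℂ)) (j + 1) =
      -(poch (-(k + 1 : ℂ)) j * (-(k + 1) + j) * (-(k + 1) + (j + 1)) / (k + 1)) := by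
    have h := poch_succ' (-(k + 1 : ℂ)) (j + 1)
    rw [poch_succ, poch_succ, show (-(k + 1 : ℂ)) + 1 = -k by ring] at h
    push_cast at h
    field_simp
    linear_combination h
  have g1 : 2 * (A - k - 1) + (k + 2 : ℕ) + 1 = A * 2 - k + 1 := by push_cast; ring
  have g2 : 2 * (A - k - 1) + (k + 1 : ℕ) + 1 = A * 2 - k := by push_cast; ring
  have g3 : poch (2 * (A - k - 1) + k + 1) (j + 1) = (A * 2 - k - 1) * poch (A * 2 - k) j := by
    rw [poch_succ']
    congr 2 <;> ring
  rw [poch_succ, show A - k - 1 + β + 1 + j = A + β - k + j by ring] at hp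
  have q1 := left_ne_zero_of_mul hp
  have q2 := right_ne_zero_of_mul hp
  have q3 : (j.factorial : ℂ) ≠ 0 := by exact_mod_cast j.factorial_ne_zero
  have q4 : (j : ℂ) + 1 ≠ 0 := by exact_mod_cast j.succ_ne_zero
  simp only [pjCoeff, z0, z1, z2, e1, e2, e3, g1, g2, g3, poch_two_mul_add n1, poch_succ,
    Nat.factorial_succ]
  push_cast
  generalize poch (A - k - 1 + β + 1) j = X at *
  generalize poch (A * 2 - k) j = Y at *
  generalize poch (-(k + 1 : ℂ)) j = D at *
  generalize (j.factorial : ℂ) = J at *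
  clear e1 e2 e3 g1 g2 g3 z0 z1 z2 h hp
  generalize (k : ℂ) = k, (j : ℂ) = j at *
  rw [show A - k - 1 + β + 1 + j = A + β - k + j by ring,
    show A * 2 + 2 = 2 * (A + 1) by ring]
  field_simp
  ring

open Matrix in
theorem Matrix.IsHermitian.exists_eigenvector_lt {ι : Type*} [Fintype ι] [DecidableEq ι]
    {M : Matrix ι ι ℝ} (hM : M.IsHermitian) {B : ℝ} (hB : ¬ (M - B • 1).PosSemidef) :
    ∃ θ < B, ∃ w : ι → ℝ, w ≠ 0 ∧ M *ᵥ w = θ • w := by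
  have hH : (M - B • 1).IsHermitian := hM.sub (by simp [IsHermitian])
  rw [hH.posSemidef_iff_eigenvalues_nonneg, Pi.le_def] at hB
  push Not at hB
  obtain ⟨i, hi⟩ := hB
  refine ⟨hH.eigenvalues i + B, by simpa using hi, hH.eigenvectorBasis i, ?_, ?_⟩
  · intro h
    exact hH.eigenvectorBasis.orthonormal.ne_zero i (by ext j; exact congrFun h j)
  · have := hH.mulVec_eigenvectorBasis i
    rw [sub_mulVec, smul_mulVec, one_mulVec, sub_eq_iff_eq_add] at this
    rw [this, add_smul]

open Matrix in
theorem Matrix.PosSemidef.apply_eq_zero_of_diag_eq_zero {ι : Type*} [Fintype ι] [DecidableEq ι]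
    {M : Matrix ι ι ℝ} (hM : M.PosSemidef) {i : ι} (hi : M i i = 0) (j : ι) : M j i = 0 := by
  have h := (hM.dotProduct_mulVec_zero_iff (Pi.single i 1)).1 (by simp [hi])
  simpa using congrFun h j

/-- The symmetric tridiagonal matrix with diagonal `c 0, c 1, …` and off-diagonal
`s 1, s 2, …`. -/
def jacobiMatrix (c s : ℕ → ℝ) (n : ℕ) : Matrix (Fin n) (Fin n) ℝ :=
  Matrix.of fun i j => (if (j : ℕ) = i then c i else 0) +
    ((if (j : ℕ) = i + 1 then s j else 0) + if (j : ℕ) + 1 = i then s i else 0)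

theorem isHermitian_jacobiMatrix (c s : ℕ → ℝ) (n : ℕ) : (jacobiMatrix c s n).IsHermitian := by
  ext i j
  simp only [jacobiMatrix, Matrix.conjTranspose_apply, Matrix.of_apply, star_trivial]
  congr 1
  · by_cases h : (i : ℕ) = j <;> simp [h, eq_comm]
  · rw [add_comm]
    simp only [eq_comm]

theorem jacobiMatrix_apply_self (c s : ℕ → ℝ) (n : ℕ) (i : Fin n) :
    jacobiMatrix c s n i i = c i := by
  simp [jacobiMatrix]

theorem jacobiMatrix_apply_succ (c s : ℕ → ℝ) {n k : ℕ} (h : k + 1 < n) :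
    jacobiMatrix c s n ⟨k, by omega⟩ ⟨k + 1, h⟩ = s (k + 1) := by
  simp [jacobiMatrix]
  omega

open Matrix in
theorem jacobiMatrix_mulVec (c s : ℕ → ℝ) (n : ℕ) (W : ℕ → ℝ) (hW : ∀ k, n ≤ k → W k = 0)
    (i : Fin n) : (jacobiMatrix c s n *ᵥ fun j => W j) i =
      c i * W i + (s (i + 1) * W (i + 1) + if (i : ℕ) = 0 then 0 else s i * W (i - 1)) := by
  have h : (jacobiMatrix c s n *ᵥ fun j => W j) i = ∑ j ∈ Finset.range n,
      ((if j = i then c i else 0) + ((if j = i + 1 then s j else 0) +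
        if j + 1 = i then s i else 0)) * W j := by
    rw [← Fin.sum_univ_eq_sum_range
      (fun j => ((if j = (i : ℕ) then c i else 0) + ((if j = (i : ℕ) + 1 then s j else 0) +
        if j + 1 = (i : ℕ) then s i else 0)) * W j)]
    simp [mulVec, dotProduct, jacobiMatrix]
  rw [h]
  simp only [add_mul, Finset.sum_add_distrib, ite_mul, zero_mul, Finset.sum_ite_eq',
    Finset.mem_range, i.isLt, if_true]
  congr 2
  · split_ifs with h
    · rfl
    · rw [hW _ (by omega), mul_zero]
  · obtain ⟨m, hm⟩ := i
    cases m with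
    | zero => simp
    | succ m =>
      simp only [add_left_inj, Finset.sum_ite_eq', Finset.mem_range]
      simp
      omega

open Matrix in
/-- Eigenvalues of a Jacobi matrix are zeros of the polynomials defined by the associated
three-term recurrence. -/
theorem eq_zero_of_jacobiMatrix_mulVec {c s p : ℕ → ℝ} {n : ℕ} (hn : 0 < n) {θ : ℝ}
    (hs : ∀ k, k + 1 < n → s (k + 1) ≠ 0) (h0 : p 0 = 1) (h1 : p 1 = θ - c 0)
    (hp : ∀ k, k + 2 ≤ n → p (k + 2) = (θ - c (k + 1)) * p (k + 1) - s (k + 1) ^ 2 * p k)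
    {w : Fin n → ℝ} (hw : w ≠ 0) (hθ : jacobiMatrix c s n *ᵥ w = θ • w) : p n = 0 := by
  set W : ℕ → ℝ := fun k => if h : k < n then w ⟨k, h⟩ else 0 with hWdef
  have hW : ∀ k, n ≤ k → W k = 0 := fun k hk => by simp [hWdef, hk]
  have hwW : w = fun j : Fin n => W j := by ext j; simp [hWdef]
  rw [hwW] at hθ
  have hrow (k : ℕ) (hk : k < n) : c k * W k + (s (k + 1) * W (k + 1) +
      if k = 0 then 0 else s k * W (k - 1)) = θ * W k := by
    have := congrFun hθ ⟨k, hk⟩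
    rwa [jacobiMatrix_mulVec c s n W hW] at this
  have key (k : ℕ) : (k ≤ n → W k * ∏ j ∈ Finset.range k, s (j + 1) = p k * W 0) ∧
      (k + 1 ≤ n →
        W (k + 1) * ∏ j ∈ Finset.range (k + 1), s (j + 1) = p (k + 1) * W 0) := by
    induction k with
    | zero =>
      refine ⟨fun _ => by simp [h0], fun h => ?_⟩
      have := hrow 0 hn
      simp [h1] at this ⊢
      linear_combination this
    | succ k ih =>
      refine ⟨ih.2, fun h => ?_⟩
      have := hrow (k + 1) (by omega)
      have i1 := ih.1 (by omega)
      have i2 := ih.2 (by omega)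
      rw [hp k h, Finset.prod_range_succ]
      rw [Finset.prod_range_succ] at i2 ⊢
      simp at this
      linear_combination (θ - c (k + 1)) * i2 - s (k + 1) ^ 2 * i1 +
        (∏ j ∈ Finset.range k, s (j + 1)) * s (k + 1) * this
  have hfin := (key n).1 le_rfl
  rw [hW n le_rfl, zero_mul, eq_comm, mul_eq_zero] at hfin
  refine hfin.resolve_right fun hW0 => hw ?_
  rw [hwW]
  ext k
  have hk := (key k).1 k.2.le
  rw [hW0, mul_zero, mul_eq_zero] at hk
  refine hk.resolve_right (Finset.prod_ne_zero_iff.2 fun j hj => hs j ?_)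
  have := Finset.mem_range.1 hj
  omega

/-- If `B` is a diagonal entry of an `n × n` Jacobi matrix, or the mean of its diagonal, then the
polynomial of degree `n` defined by the associated three-term recurrence has zeros on both sides
of `B`. -/
theorem exists_zero_lt_and_gt_of_recurrence {c s : ℕ → ℝ} {p : ℕ → ℝ → ℝ} {n : ℕ} (hn : 2 ≤ n)
    (hs : ∀ k, k + 1 < n → s (k + 1) ≠ 0) (h0 : ∀ x, p 0 x = 1) (h1 : ∀ x, p 1 x = x - c 0)
    (hp : ∀ k, k + 2 ≤ n → ∀ x,
      p (k + 2) x = (x - c (k + 1)) * p (k + 1) x - s (k + 1) ^ 2 * p k x)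
    {B : ℝ} (hB : (∃ k < n, c k = B) ∨ ∑ k ∈ Finset.range n, c k = n * B) :
    ∃ u v : ℝ, p n u = 0 ∧ p n v = 0 ∧ u < B ∧ B < v := by
  have hH := isHermitian_jacobiMatrix c s n
  have hne : ∀ ε : ℝ, ε ≠ 0 →
      ¬ (ε • (jacobiMatrix c s n - B • (1 : Matrix (Fin n) (Fin n) ℝ))).PosSemidef := by
    intro ε hε hpos
    have hoff (k : ℕ) (hk : k + 1 < n) :
        (ε • (jacobiMatrix c s n - B • (1 : Matrix (Fin n) (Fin n) ℝ)))
        ⟨k, by omega⟩ ⟨k + 1, hk⟩ ≠ 0 := by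
      simp [jacobiMatrix_apply_succ, hε, hs k hk]
    rcases hB with ⟨k, hk, hck⟩ | hsum
    · have hz := hpos.apply_eq_zero_of_diag_eq_zero (i := ⟨k, hk⟩)
        (by simp [jacobiMatrix_apply_self, hck])
      rcases Nat.lt_or_ge (k + 1) n with h | h
      · refine hoff k h ?_
        have := hpos.1.apply ⟨k, hk⟩ ⟨k + 1, h⟩
        rw [hz] at this
        simpa using this.symm
      · obtain ⟨m, rfl⟩ : ∃ m, k = m + 1 := ⟨k - 1, by omega⟩
        exact hoff m hk (hz _)
    · have htr : (ε • (jacobiMatrix c s n - B • (1 : Matrix (Fin n) (Fin n) ℝ))).trace = 0 := by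
        simp only [Matrix.trace_smul, Matrix.trace_sub, Matrix.trace_one, Fintype.card_fin]
        simp only [Matrix.trace, Matrix.diag_apply, jacobiMatrix_apply_self]
        rw [Fin.sum_univ_eq_sum_range c, hsum]
        simp [mul_comm]
      have := (hpos.trace_eq_zero_iff).1 htr
      exact hoff 0 (by omega) (by rw [this]; rfl)
  obtain ⟨u, hu, w, hw, hwu⟩ := hH.exists_eigenvector_lt (B := B) (by simpa using hne 1 one_ne_zero)
  obtain ⟨v, hv, z, hz, hzv⟩ := hH.neg.exists_eigenvector_lt (B := -B) (by
    have := hne (-1) (by norm_num)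
    rwa [neg_one_smul, neg_sub', ← neg_smul] at this)
  rw [Matrix.neg_mulVec, neg_eq_iff_eq_neg, ← neg_smul] at hzv
  exact ⟨u, -v,
    eq_zero_of_jacobiMatrix_mulVec (p := fun k => p k u) (by omega) hs (h0 _) (h1 _)
      (fun k hk => hp k hk _) hw hwu,
    eq_zero_of_jacobiMatrix_mulVec (p := fun k => p k (-v)) (by omega) hs (h0 _) (h1 _)
      (fun k hk => hp k hk _) hz hzv,
    hu, by linarith⟩

theorem poch_neg_natCast_eq_zero {k j : ℕ} (h : k < j) : poch (-(k : ℂ)) j = 0 :=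
  Finset.prod_eq_zero (Finset.mem_range.2 h) (by simp)

theorem pjCoeff_eq_zero (a β : ℂ) {k j : ℕ} (h : k < j) : pjCoeff a β k j = 0 := by
  simp [pjCoeff, poch_neg_natCast_eq_zero h]

theorem pseudoJacobi_eq_sum (a b : ℝ) {k N : ℕ} (h : k < N) (x : ℂ) :
    pseudoJacobi a b k x = (-2 * Complex.I) ^ k * (-1) ^ k *
      ∑ j ∈ Finset.range N, pjCoeff a (Complex.I * b) k j * ((1 - Complex.I * x) / 2) ^ j := by
  have hI : (2 : ℂ) ^ k / Complex.I ^ k = (-2 * Complex.I) ^ k := by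
    rw [← div_pow, Complex.div_I]
    ring
  rw [← Finset.sum_subset (Finset.range_subset_range.2 (Nat.succ_le_of_lt h))
    (fun j _ hj => by
      rw [pjCoeff_eq_zero _ _ (by simpa [Nat.lt_succ_iff] using hj), zero_mul])]
  rw [pseudoJacobi, mul_div_mul_comm, hI]
  simp only [pjCoeff, pjLead, Finset.mul_sum]
  have h1 : ((-1 : ℂ) ^ k) * (-1) ^ k = 1 := by rw [← mul_pow]; simp
  refine Finset.sum_congr rfl fun j _ => ?_
  linear_combination -((-2 * Complex.I) ^ k *
    (poch ((a : ℂ) + Complex.I * b + 1) k / poch (2 * (a : ℂ) + k + 1) k) *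
    (poch (-(k : ℂ)) j * poch (2 * (a : ℂ) + k + 1) j /
      (poch ((a : ℂ) + Complex.I * b + 1) j * (j.factorial : ℂ)) *
      ((1 - Complex.I * x) / 2) ^ j)) * h1

/-- The diagonal coefficients of the three-term recurrence of the Pseudo-Jacobi polynomials. -/
noncomputable def pjDiag (a b : ℝ) (k : ℕ) : ℝ := -(a * b) / ((a + k) * (a + k + 1))

/-- The remaining coefficients of the three-term recurrence of the Pseudo-Jacobi polynomials. -/
noncomputable def pjWeight (a b : ℝ) (k : ℕ) : ℝ :=
  -(k * (2 * a + k) * ((a + k) ^ 2 + b ^ 2)) /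
    ((a + k) ^ 2 * (2 * a + 2 * k - 1) * (2 * a + 2 * k + 1))

theorem pjWeight_pos {a : ℝ} (b : ℝ) {k : ℕ} (hk : 0 < k) (ha : a < -(k + 1 : ℝ)) :
    0 < pjWeight a b k := by
  have hk' : (0 : ℝ) < k := by exact_mod_cast hk
  have h1 : 0 < -(2 * a + k) := by linarith
  have h2 : 0 < (a + k) ^ 2 := by
    have : a + k ≠ 0 := by linarith
    positivity
  have h3 : 0 < (2 * a + 2 * k - 1) * (2 * a + 2 * k + 1) :=
    mul_pos_of_neg_of_neg (by linarith) (by linarith)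
  rw [pjWeight, mul_assoc ((a + k) ^ 2),
    show -(k * (2 * a + k) * ((a + k) ^ 2 + b ^ 2)) =
      k * -(2 * a + k) * ((a + k) ^ 2 + b ^ 2) by ring]
  positivity

theorem pseudoJacobi_zero (a b : ℝ) (x : ℂ) : pseudoJacobi a b 0 x = 1 := by
  simp [pseudoJacobi, poch]

theorem pseudoJacobi_one {a : ℝ} (b : ℝ) (ha : a < -1) (x : ℂ) :
    pseudoJacobi a b 1 x = x - pjDiag a b 0 := by
  have h0 : (a : ℂ) ≠ 0 := by exact_mod_cast (by linarith : a ≠ 0)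
  have h1 : (a : ℂ) + 1 ≠ 0 := by exact_mod_cast (by linarith : a + 1 ≠ 0)
  have h2 : (a : ℂ) + Complex.I * b + 1 ≠ 0 := by
    intro h
    have := congrArg Complex.re h
    simp at this
    linarith
  simp only [pseudoJacobi, poch, pjDiag, Finset.sum_range_succ, Finset.sum_range_zero,
    Finset.prod_range_one, Finset.prod_range_zero, pow_one, pow_zero, Nat.factorial]
  push_cast
  have h4 : 2 * (a : ℂ) + 1 + 1 = 2 * (a + 1) := by ring
  rw [add_zero, add_zero, add_zero, add_zero, h4]
  have hI0 := Complex.I_ne_zero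
  field_simp
  ring

theorem pseudoJacobi_recurrence {a : ℝ} (b : ℝ) {k : ℕ} (ha : a < -(k + 2 : ℝ)) (x : ℂ) :
    pseudoJacobi a b (k + 2) x = (x - pjDiag a b (k + 1)) * pseudoJacobi a b (k + 1) x -
      pjWeight a b (k + 1) * pseudoJacobi a b k x := by
  have hk0 : (0 : ℝ) ≤ k := k.cast_nonneg
  set β : ℂ := Complex.I * b with hβ
  set A : ℂ := (a : ℂ) + k + 1 with hAdef
  have haA : (a : ℂ) = A - k - 1 := by rw [hAdef]; ring
  have hA : A ≠ 0 := by
    rw [hAdef]; exact_mod_cast (by linarith : a + k + 1 ≠ 0)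
  have hA1 : A + 1 ≠ 0 := by
    rw [hAdef]; exact_mod_cast (by linarith : a + k + 1 + 1 ≠ 0)
  have h3 : A * 2 + 1 ≠ 0 := by
    rw [hAdef]; exact_mod_cast (by linarith : (a + k + 1) * 2 + 1 ≠ 0)
  have h1 : A * 2 - 1 ≠ 0 := by
    rw [hAdef]; exact_mod_cast (by linarith : (a + k + 1) * 2 - 1 ≠ 0)
  have hm (m : ℕ) (hm : m ≤ k + 2) : A * 2 - k - 1 + m ≠ 0 := by
    have : (m : ℝ) ≤ k + 2 := by exact_mod_cast hm
    rw [hAdef]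
    exact_mod_cast (by linarith : (a + k + 1) * 2 - k - 1 + m ≠ 0)
  have hp (j : ℕ) (hj : j ∈ Finset.range (k + 2)) : poch (A - k - 1 + β + 1) (j + 1) ≠ 0 := by
    rw [← haA, poch, Finset.prod_ne_zero_iff]
    intro i hi h
    have : (i : ℝ) ≤ k + 1 := by
      have := Finset.mem_range.1 hi
      have := Finset.mem_range.1 hj
      exact_mod_cast (by omega : i ≤ k + 1)
    have := congrArg Complex.re h
    simp [hβ] at this
    linarith
  set t : ℂ := (1 - Complex.I * x) / 2 with ht
  have hx : x = Complex.I * (2 * t - 1) := by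
    rw [ht]; linear_combination x * Complex.I_sq
  set d : ℂ := -1 / 2 - (A - k - 1) * β / (A * (A + 1)) / 2 with hd
  set e : ℂ := ((k + 1) * (A * 2 - k - 1) * (A ^ 2 - β ^ 2) /
        (A ^ 2 * (A * 2 - 1) * (A * 2 + 1))) / 4 with he
  have hzero : pjCoeff a β (k + 2) 0 = d * pjCoeff a β (k + 1) 0 - e * pjCoeff a β k 0 := by
    rw [haA]
    exact pjCoeff_zero_rec hA hA1 h3 h1 hm
  have hsucc (j : ℕ) (hj : j ∈ Finset.range (k + 2)) : pjCoeff a β (k + 2) (j + 1) =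
      pjCoeff a β (k + 1) j + d * pjCoeff a β (k + 1) (j + 1) - e * pjCoeff a β k (j + 1) := by
    rw [haA]
    exact pjCoeff_succ_rec hA hA1 h3 h1 hm (hp j hj)
  have hsum : ∑ j ∈ Finset.range (k + 3), pjCoeff a β (k + 2) j * t ^ j =
      (t + d) * ∑ j ∈ Finset.range (k + 3), pjCoeff a β (k + 1) j * t ^ j -
        e * ∑ j ∈ Finset.range (k + 3), pjCoeff a β k j * t ^ j := by
    have hshift : t * ∑ j ∈ Finset.range (k + 3), pjCoeff a β (k + 1) j * t ^ j =
        ∑ j ∈ Finset.range (k + 2), pjCoeff a β (k + 1) j * t ^ (j + 1) := by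
      rw [Finset.sum_range_succ, pjCoeff_eq_zero _ _ (by omega), zero_mul, add_zero,
        Finset.mul_sum]
      exact Finset.sum_congr rfl fun j _ => by ring
    rw [add_mul, hshift]
    simp only [Finset.sum_range_succ' _ (k + 2), pow_zero, mul_one]
    rw [hzero, Finset.sum_congr rfl fun j hj => by rw [hsucc j hj]]
    simp only [sub_mul, add_mul, Finset.sum_sub_distrib, Finset.sum_add_distrib,
      mul_add, Finset.mul_sum, mul_assoc]
    ring
  have hc : (pjDiag a b (k + 1) : ℂ) = 2 * Complex.I * (-1 / 2 - d) := by
    rw [pjDiag, hd, hβ]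
    push_cast
    rw [haA, show A - k - 1 + (k + 1) = A by ring]
    field_simp
    linear_combination -((A - k - 1) * b) * Complex.I_sq
  have hw : (pjWeight a b (k + 1) : ℂ) = -4 * e := by
    rw [pjWeight, he, hβ, mul_pow, Complex.I_sq]
    push_cast
    rw [haA, show A - k - 1 + (k + 1) = A by ring,
      show 2 * (A - k - 1) + 2 * (k + 1) - 1 = A * 2 - 1 by ring,
      show 2 * (A - k - 1) + 2 * (k + 1) + 1 = A * 2 + 1 by ring,
      show 2 * (A - k - 1) + (k + 1) = A * 2 - k - 1 by ring]
    field_simp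
    ring
  rw [pseudoJacobi_eq_sum a b (show k + 2 < k + 3 by omega),
    pseudoJacobi_eq_sum a b (show k + 1 < k + 3 by omega),
    pseudoJacobi_eq_sum a b (show k < k + 3 by omega), hc, hw, ← hβ, ← ht, hsum, hx]
  simp only [pow_succ]
  linear_combination 4 * e * (-2 * Complex.I) ^ k * (-1) ^ k *
    (∑ j ∈ Finset.range (k + 3), pjCoeff a β k j * t ^ j) * -Complex.I_sq

/-- The monic real polynomials, as functions, defined by the three-term recurrence
`p_{k+2} = (x - c_{k+1}) p_{k+1} - l_{k+1} p_k`. -/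
noncomputable def threeTerm (c l : ℕ → ℝ) : ℕ → ℝ → ℝ
  | 0, _ => 1
  | 1, x => x - c 0
  | k + 2, x => (x - c (k + 1)) * threeTerm c l (k + 1) x - l (k + 1) * threeTerm c l k x

theorem pseudoJacobi_eq_threeTerm {a : ℝ} (b : ℝ) (x : ℝ) (k : ℕ) (ha : a < -(k : ℝ)) :
    pseudoJacobi a b k x = (threeTerm (pjDiag a b) (pjWeight a b) k x : ℝ) := by
  induction k using Nat.twoStepInduction with
  | zero => simp [pseudoJacobi_zero, threeTerm]
  | one => simp [pseudoJacobi_one b (by simpa using ha), threeTerm]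
  | more k ih0 ih1 =>
    push_cast at ha ih1
    rw [pseudoJacobi_recurrence b ha, ih0 (by linarith), ih1 (by linarith), threeTerm]
    push_cast
    rfl

theorem sum_pjDiag {a : ℝ} (b : ℝ) {n : ℕ} (ha : a < -(n : ℝ)) :
    ∑ k ∈ Finset.range n, pjDiag a b k = n * (-b / (a + n)) := by
  induction n with
  | zero => simp
  | succ n ih =>
    push_cast at ha ⊢
    have hn : (0 : ℝ) ≤ n := n.cast_nonneg
    have h1 : a + n ≠ 0 := by linarith
    have h2 : a + n + 1 ≠ 0 := by linarith
    rw [Finset.sum_range_succ, ih (by linarith), pjDiag, ← add_assoc a]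
    field_simp
    ring

/-- **Inner bounds for the extreme zeros of Pseudo-Jacobi polynomials:** for `b ∈ ℝ`,
`n ≥ 2` and `a < −n`, each of `B_n(0), B_n(1), B_n(2)` lies strictly between the
smallest and the largest real zero of `P_n(x;a,b)`. -/
theorem pseudoJacobi_inner_bounds (a b : ℝ) (n : ℕ) (hn : 2 ≤ n)
    (ha : a < -(n : ℝ)) :
    ∀ i : Fin 3, ∃ u v : ℝ,
      pseudoJacobi a b n (u : ℂ) = 0 ∧
      pseudoJacobi a b n (v : ℂ) = 0 ∧
      u < pjBound a b n i ∧ pjBound a b n i < v := by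
  intro i
  have hpos (k : ℕ) (hk : k + 1 < n) : 0 < pjWeight a b (k + 1) := by
    have : (k : ℝ) + 2 ≤ n := by exact_mod_cast hk
    exact pjWeight_pos b k.succ_pos (by push_cast; linarith)
  have h0 : a ≠ 0 := by
    have : (0 : ℝ) ≤ n := n.cast_nonneg
    linarith
  have hB : (∃ k < n, pjDiag a b k = pjBound a b n i) ∨
      ∑ k ∈ Finset.range n, pjDiag a b k = n * pjBound a b n i := by
    fin_cases i
    · obtain ⟨m, rfl⟩ : ∃ m, n = m + 1 := ⟨n - 1, by omega⟩
      refine Or.inl ⟨m, by omega, ?_⟩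
      simp [pjDiag, pjBound]
      ring
    · exact Or.inr (by simpa [pjBound] using sum_pjDiag b ha)
    · refine Or.inl ⟨0, by omega, ?_⟩
      simp only [pjDiag, pjBound, Fin.reduceFinMk, Matrix.cons_val, Nat.cast_zero, add_zero]
      rw [neg_mul_eq_mul_neg, mul_div_mul_left _ _ h0]
  obtain ⟨u, v, hu, hv, huB, hBv⟩ := exists_zero_lt_and_gt_of_recurrence
    (c := pjDiag a b) (s := fun k => √(pjWeight a b k))
    (p := threeTerm (pjDiag a b) (pjWeight a b)) hn
    (fun k hk => (Real.sqrt_pos.2 (hpos k hk)).ne') (fun _ => rfl) (fun _ => rfl)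
    (fun k hk x => by rw [Real.sq_sqrt (hpos k hk).le, threeTerm]) hB
  exact ⟨u, v, by rw [pseudoJacobi_eq_threeTerm b u n ha, hu, Complex.ofReal_zero],
    by rw [pseudoJacobi_eq_threeTerm b v n ha, hv, Complex.ofReal_zero], huB, hBv⟩
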